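/- Shill bidding is unprofitable (Theorem 4(ii)): suppose every participant's bid cost function c_j is strictly increasing, satisfies condition (i), and has c_j(0) = 0. Let L ⊆ Z be the participants, S ⊆ L a subset (interpreted as multiple identities of a single bidder) with L∖S nonempty and L∖{j} nonempty for every j ∈ S, and let p* be an optimal allocation for L. Then the total VCG (Clarke pivot) payment received by the members of S is bounded by the marginal value of S as a whole: Σ_{j∈S} q_j(L) ≤ J*(L∖S) − J*(L) + Σ_{j∈S} c_j(p*_j), where q_j(L) = J*(L∖{j}) − J*(L) + c_j(p*_j); equivalently, Σ_{j∈S} (J*(L∖{j}) − J*(L)) ≤ J*(L∖S) − J*(L). -/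

import Mathlib

/-!
STATEMENT 14: Shill bidding is unprofitable (Theorem 4(ii) of Sessa, Walton,
Kamgarpour), in the concrete clearing model (4).

`Z` is a finite set of potential participants; the auctioneer must procure
`M` units of power.  Participant `j` has bid cost function `c j : ℕ → ℝ` with
`c j 0 = 0`.  An allocation for a nonempty `S ⊆ Z` is `p : α → ℕ` supported on
`S` with `∑_{j ∈ S} p j ≥ M`; its cost is `∑_{j ∈ S} c j (p j)`; `Jstar S` is
the minimum cost over allocations for `S`.  The Clarke pivot payment to `j ∈ L`
with optimal allocation `pstar` is `q j = Jstar (L \ {j}) - Jstar L + c j (pstar j)`.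

Suppose every participant's bid cost function is strictly increasing, satisfies
condition (i), and vanishes at `0`.  Let `L ⊆ Z` be the participants, `S ⊆ L`
(multiple identities of a single bidder) with `L \ S` nonempty and `L \ {j}`
nonempty for every `j ∈ S`, and let `pstar` be an optimal allocation for `L`.
Then the total VCG payment received by the members of `S` is bounded by the
marginal value of `S` as a whole:
`∑_{j ∈ S} q j ≤ Jstar (L \ S) - Jstar L + ∑_{j ∈ S} c j (pstar j)`;
equivalently, `∑_{j ∈ S} (Jstar (L \ {j}) - Jstar L) ≤ Jstar (L \ S) - Jstar L`.
-/

/-- `p` is a feasible allocation for participants `S` with procurement target `M`. -/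
def IsAlloc {α : Type*} [DecidableEq α] (S : Finset α) (M : ℕ) (p : α → ℕ) : Prop :=
  (∀ j ∉ S, p j = 0) ∧ M ≤ ∑ j ∈ S, p j

/-- The cost of allocation `p` for participants `S` under cost functions `c`. -/
def allocCost {α : Type*} (c : α → ℕ → ℝ) (S : Finset α) (p : α → ℕ) : ℝ :=
  ∑ j ∈ S, c j (p j)

/-- Condition (i): strictly increasing marginal cost. -/
def StrictlyIncreasingMarginalCost (b : ℕ → ℝ) : Prop :=
  ∀ k : ℕ, b (k + 1) - b k < b (k + 2) - b (k + 1)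

lemma aux_upd {α : Type*} [DecidableEq α] (f : α → ℕ → ℝ) (T : Finset α) (q : α → ℕ) (a : α)
    (ha : a ∈ T) (u : ℕ) :
    ∑ j ∈ T, f j (Function.update q a u j) = ∑ j ∈ T, f j (q j) - f a (q a) + f a u := by
  rw [← Finset.add_sum_erase T _ ha, ← Finset.add_sum_erase T (fun j => f j (q j)) ha]
  have : ∑ j ∈ T.erase a, f j (Function.update q a u j) = ∑ j ∈ T.erase a, f j (q j) := by
    apply Finset.sum_congr rfl
    intro x hx
    rw [Function.update_of_ne (Finset.ne_of_mem_erase hx)]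
  rw [this]
  simp
  ring

lemma aux_marg {b : ℕ → ℝ} (h : StrictlyIncreasingMarginalCost b) {m n : ℕ} (hmn : m ≤ n) :
    b (m + 1) - b m ≤ b (n + 1) - b n := by
  have : Monotone (fun k => b (k + 1) - b k) := monotone_nat_of_le_succ (fun k => (h k).le)
  exact this hmn

lemma aux_conv {b : ℕ → ℝ} (h : StrictlyIncreasingMarginalCost b) {m n : ℕ} (hmn : m ≤ n)
    (x : ℕ) : b (m + x) - b m ≤ b (n + x) - b n := by
  induction x with
  | zero => simp
  | succ x ih =>
    have := aux_marg h (show m + x ≤ n + x by omega)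
    simp only [← add_assoc]
    linarith

lemma aux_split {α : Type*} [DecidableEq α] (R : Finset α) (f : α → ℕ) :
    ∀ n : ℕ, n ≤ ∑ i ∈ R, f i → ∃ x : α → ℕ, (∀ i ∈ R, x i ≤ f i) ∧ ∑ i ∈ R, x i = n := by
  induction R using Finset.induction_on with
  | empty => intro n hn; exact ⟨fun _ => 0, by simp, by simp at hn ⊢; omega⟩
  | insert a R ha ih =>
    intro n hn
    rw [Finset.sum_insert ha] at hn
    obtain ⟨x, hx, hs⟩ := ih (n - min n (f a)) (by omega)
    refine ⟨Function.update x a (min n (f a)), ?_, ?_⟩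
    · intro i hi
      by_cases hia : i = a
      · subst hia; simp
      · rw [Function.update_of_ne hia]
        exact hx i (Finset.mem_of_mem_insert_of_ne hi hia)
    · rw [Finset.sum_insert ha, Finset.sum_update_of_notMem ha, hs]
      simp

/-- Optimal allocations procure exactly `M`. -/
lemma aux_exact {α : Type*} [DecidableEq α] {M : ℕ} {c : α → ℕ → ℝ}
    (hinc : ∀ j, StrictMono (c j)) {L : Finset α} {p : α → ℕ} (hps : IsAlloc L M p)
    (hopt : ∀ q : α → ℕ, IsAlloc L M q → allocCost c L p ≤ allocCost c L q) :
    ∑ j ∈ L, p j = M := by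
  by_contra hne
  have hlt : M < ∑ j ∈ L, p j := lt_of_le_of_ne hps.2 (Ne.symm hne)
  obtain ⟨a, ha, hpa⟩ : ∃ a ∈ L, p a ≠ 0 := by
    by_contra! hcon
    rw [Finset.sum_eq_zero hcon] at hlt
    omega
  have h1 := aux_upd (fun _ n => (n : ℝ)) L p a ha (p a - 1)
  have h2 := aux_upd c L p a ha (p a - 1)
  have h3 := hopt (Function.update p a (p a - 1)) (by
    refine ⟨?_, ?_⟩
    · intro j hj
      rw [Function.update_of_ne (by rintro rfl; exact hj ha)]
      exact hps.1 j hj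
    · rw [Nat.cast_sub (by omega)] at h1
      have h1' : (((∑ j ∈ L, Function.update p a (p a - 1) j) + 1 : ℕ) : ℝ)
          = ((∑ j ∈ L, p j : ℕ) : ℝ) := by
        push_cast
        rw [h1]
        push_cast
        ring
      have := Nat.cast_injective h1'
      omega)
  unfold allocCost at h3
  have := hinc a (show p a - 1 < p a by omega)
  linarith

lemma aux_two {α : Type*} [DecidableEq α] (f : α → ℕ → ℝ) (T : Finset α) (q : α → ℕ) (a b : α)
    (hab : a ≠ b) (ha : a ∈ T) (hb : b ∈ T) (u v : ℕ) :
    ∑ j ∈ T, f j (Function.update (Function.update q a u) b v j)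
      = ∑ j ∈ T, f j (q j) - f a (q a) + f a u - f b (q b) + f b v := by
  rw [aux_upd f T _ b hb, aux_upd f T q a ha, Function.update_of_ne hab.symm]

lemma aux_two_sum {α : Type*} [DecidableEq α] (T : Finset α) (q : α → ℕ) (a b : α)
    (hab : a ≠ b) (ha : a ∈ T) (hb : b ∈ T) (hq : 1 ≤ q a) :
    ∑ j ∈ T, Function.update (Function.update q a (q a - 1)) b (q b + 1) j = ∑ j ∈ T, q j := by
  have h1 := aux_two (fun _ n => (n : ℝ)) T q a b hab ha hb (q a - 1) (q b + 1)
  rw [Nat.cast_sub hq] at h1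
  have h : ((∑ j ∈ T, Function.update (Function.update q a (q a - 1)) b (q b + 1) j : ℕ) : ℝ)
      = ((∑ j ∈ T, q j : ℕ) : ℝ) := by
    push_cast
    rw [h1]
    push_cast
    ring
  exact Nat.cast_injective h

lemma aux_exch {α : Type*} [DecidableEq α] {M : ℕ} {c : α → ℕ → ℝ}
    {L : Finset α} {p : α → ℕ} (hps : IsAlloc L M p)
    (hopt : ∀ q : α → ℕ, IsAlloc L M q → allocCost c L p ≤ allocCost c L q)
    {a b : α} (hab : a ≠ b) (ha : a ∈ L) (hb : b ∈ L) (hq : 1 ≤ p a) :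
    c a (p a) - c a (p a - 1) ≤ c b (p b + 1) - c b (p b) := by
  have h1 := aux_two_sum L p a b hab ha hb hq
  have h2 := aux_two c L p a b hab ha hb (p a - 1) (p b + 1)
  have h3 := hopt _ (show IsAlloc L M
      (Function.update (Function.update p a (p a - 1)) b (p b + 1)) from by
    refine ⟨?_, by rw [h1]; exact hps.2⟩
    intro j hj
    rw [Function.update_of_ne (by rintro rfl; exact hj hb),
      Function.update_of_ne (by rintro rfl; exact hj ha)]
    exact hps.1 j hj)
  unfold allocCost at h3
  linarith

lemma aux_dom {α : Type*} [DecidableEq α] {M : ℕ} {c : α → ℕ → ℝ}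
    (hmarg : ∀ j, StrictlyIncreasingMarginalCost (c j))
    {L : Finset α} {p : α → ℕ} (hps : IsAlloc L M p)
    (hopt : ∀ q : α → ℕ, IsAlloc L M q → allocCost c L p ≤ allocCost c L q)
    (R : Finset α) (hR : R ⊆ L) :
    ∀ (n : ℕ) (r : α → ℕ), ∑ i ∈ R, (p i - r i) = n → ∑ i ∈ R, p i ≤ ∑ i ∈ R, r i →
      ∃ y : α → ℕ, (∀ i ∈ R, p i ≤ y i) ∧ ∑ i ∈ R, y i = ∑ i ∈ R, r i ∧
        ∑ i ∈ R, c i (y i) ≤ ∑ i ∈ R, c i (r i) := by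
  intro n
  induction n with
  | zero =>
    intro r hn _
    refine ⟨r, ?_, rfl, le_rfl⟩
    intro i hi
    have := Finset.sum_eq_zero_iff.1 hn i hi
    omega
  | succ n ih =>
    intro r hn hle
    obtain ⟨i, hi, hpi⟩ : ∃ i ∈ R, p i - r i ≠ 0 := by
      by_contra! hcon
      rw [Finset.sum_eq_zero hcon] at hn
      omega
    obtain ⟨k, hk, hpk⟩ : ∃ k ∈ R, p k < r k := by
      by_contra! hcon
      have := Finset.sum_lt_sum hcon ⟨i, hi, by omega⟩
      omega
    have hki : k ≠ i := by rintro rfl; omega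
    have hs := aux_two_sum R r k i hki hk hi (by omega)
    have hc := aux_two c R r k i hki hk hi (r k - 1) (r i + 1)
    have hd := aux_two (fun j m => ((p j - m : ℕ) : ℝ)) R r k i hki hk hi (r k - 1) (r i + 1)
    simp only [show p k - r k = 0 by omega, show p k - (r k - 1) = 0 by omega,
      show p i - r i = (p i - (r i + 1)) + 1 by omega] at hd
    obtain ⟨y, hy1, hy2, hy3⟩ :=
      ih (Function.update (Function.update r k (r k - 1)) i (r i + 1)) (by
        have h : ((∑ j ∈ R, (p j - Function.update (Function.update r k (r k - 1)) i
            (r i + 1) j) + 1 : ℕ) : ℝ) = ((∑ j ∈ R, (p j - r j) : ℕ) : ℝ) := by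
          rw [Nat.cast_add, Nat.cast_sum, hd, Nat.cast_sum]
          push_cast
          ring
        have := Nat.cast_injective h
        omega) (by rw [hs]; exact hle)
    refine ⟨y, hy1, hy2.trans hs, hy3.trans ?_⟩
    have e := aux_exch hps hopt hki.symm (hR hi) (hR hk) (by omega)
    have m1 := aux_marg (hmarg i) (show r i ≤ p i - 1 by omega)
    have m2 := aux_marg (hmarg k) (show p k ≤ r k - 1 by omega)
    rw [show p i - 1 + 1 = p i by omega] at m1
    rw [show r k - 1 + 1 = r k by omega] at m2
    linarith

theorem shill_bidding_unprofitable
    {α : Type*} [DecidableEq α] (Z : Finset α) (M : ℕ)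
    (c : α → ℕ → ℝ)
    (hc0 : ∀ j, c j 0 = 0)
    (hinc : ∀ j, StrictMono (c j))
    (hmarg : ∀ j, StrictlyIncreasingMarginalCost (c j))
    (Jstar : Finset α → ℝ)
    (hJstar : ∀ T : Finset α, T ⊆ Z → T.Nonempty →
      IsLeast {r : ℝ | ∃ p : α → ℕ, IsAlloc T M p ∧ r = allocCost c T p} (Jstar T))
    (L : Finset α) (hLZ : L ⊆ Z)
    (S : Finset α) (hSL : S ⊆ L)
    (hLS : (L \ S).Nonempty)
    (hLj : ∀ j ∈ S, (L.erase j).Nonempty)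
    (pstar : α → ℕ)
    (hps : IsAlloc L M pstar)
    (hpsopt : ∀ q : α → ℕ, IsAlloc L M q →
      allocCost c L pstar ≤ allocCost c L q) :
    (∑ j ∈ S, (Jstar (L.erase j) - Jstar L + c j (pstar j)) ≤
        Jstar (L \ S) - Jstar L + ∑ j ∈ S, c j (pstar j))
    ∧ (∑ j ∈ S, (Jstar (L.erase j) - Jstar L) ≤ Jstar (L \ S) - Jstar L) := by
  have key : ∑ j ∈ S, (Jstar (L.erase j) - Jstar L) ≤ Jstar (L \ S) - Jstar L := by
    have hR : L \ S ⊆ L := Finset.sdiff_subset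
    have hLne : L.Nonempty := hLS.mono hR
    have hJL : Jstar L = allocCost c L pstar := by
      obtain ⟨⟨q, hq, hqe⟩, hlb⟩ := hJstar L hLZ hLne
      apply le_antisymm
      · exact hlb ⟨pstar, hps, rfl⟩
      · rw [hqe]; exact hpsopt q hq
    have hM := aux_exact hinc hps hpsopt
    have hsum : ∀ f : α → ℝ, ∑ j ∈ L, f j = ∑ j ∈ L \ S, f j + ∑ j ∈ S, f j :=
      fun f => (Finset.sum_sdiff hSL).symm
    have hsumN : ∑ j ∈ L \ S, pstar j + ∑ j ∈ S, pstar j = M := by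
      rw [Finset.sum_sdiff hSL, hM]
    obtain ⟨⟨r, hr, hre⟩, -⟩ := hJstar (L \ S) (hR.trans hLZ) hLS
    have hr2 := hr.2
    obtain ⟨y, hy1, hy2, hy3⟩ := aux_dom hmarg hps hpsopt (L \ S) hR _ r rfl (by omega)
    have main : ∀ T : Finset α, T ⊆ S → ∀ y : α → ℕ, (∀ i ∈ L \ S, pstar i ≤ y i) →
        ∑ i ∈ L \ S, pstar i + ∑ j ∈ T, pstar j ≤ ∑ i ∈ L \ S, y i →
        ∑ j ∈ T, (Jstar (L.erase j) - Jstar L + c j (pstar j)) ≤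
          ∑ i ∈ L \ S, c i (y i) - ∑ i ∈ L \ S, c i (pstar i) := by
      intro T
      induction T using Finset.induction_on with
      | empty =>
        intro _ y hy _
        have := Finset.sum_le_sum (fun i hi => (hinc i).monotone (hy i hi))
        simpa using this
      | insert j T hj ih =>
        intro hT y hy hle
        have hjS : j ∈ S := hT (Finset.mem_insert_self _ _)
        have hjL : j ∈ L := hSL hjS
        have hjR : j ∉ L \ S := by simp [hjS]
        rw [Finset.sum_insert hj] at hle ⊢
        have hyp : ∑ i ∈ L \ S, (y i - pstar i) + ∑ i ∈ L \ S, pstar i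
            = ∑ i ∈ L \ S, y i := by
          rw [← Finset.sum_add_distrib]
          exact Finset.sum_congr rfl (fun i hi => Nat.sub_add_cancel (hy i hi))
        obtain ⟨x, hx, hxs⟩ := aux_split (L \ S) (fun i => y i - pstar i) (pstar j) (by omega)
        have hyx : ∑ i ∈ L \ S, (y i - x i) + ∑ i ∈ L \ S, x i = ∑ i ∈ L \ S, y i := by
          rw [← Finset.sum_add_distrib]
          refine Finset.sum_congr rfl (fun i hi => Nat.sub_add_cancel ?_)
          have := hx i hi
          omega
        have h1 := ih (fun a ha => hT (Finset.mem_insert_of_mem ha)) (fun i => y i - x i)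
          (by
            intro i hi
            have := hx i hi
            have := hy i hi
            show pstar i ≤ y i - x i
            omega) (by omega)
        have h2 : Jstar (L.erase j) ≤ ∑ i ∈ L \ S, c i (pstar i + x i)
            + ∑ i ∈ S.erase j, c i (pstar i) := by
          have hsd : L.erase j = (L \ S) ∪ S.erase j := by
            ext a
            have := @hSL a
            simp only [Finset.mem_erase, Finset.mem_union, Finset.mem_sdiff]
            by_cases a = j <;> by_cases a ∈ S <;> simp_all
          have hdis : Disjoint (L \ S) (S.erase j) :=
            Finset.disjoint_sdiff.symm.mono_right (Finset.erase_subset _ _)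
          let q : α → ℕ := fun i => if i ∈ L \ S then pstar i + x i else
            if i ∈ S.erase j then pstar i else 0
          have hq1 : ∀ i ∈ L \ S, q i = pstar i + x i := fun i hi => if_pos hi
          have hq2 : ∀ i ∈ S.erase j, q i = pstar i := fun i hi => by
            have : i ∉ L \ S := fun h => Finset.disjoint_left.1 hdis h hi
            simp only [q, if_neg this, if_pos hi]
          refine (hJstar (L.erase j) ((Finset.erase_subset _ _).trans hLZ) (hLj j hjS)).2
            ⟨q, ⟨?_, ?_⟩, ?_⟩
          · intro i hi
            rw [hsd, Finset.mem_union, not_or] at hi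
            simp only [q, if_neg hi.1, if_neg hi.2]
          · have e2 : ∑ i ∈ S.erase j, q i = ∑ i ∈ S.erase j, pstar i :=
              Finset.sum_congr rfl hq2
            rw [hsd, Finset.sum_union hdis, Finset.sum_congr rfl hq1, e2,
              Finset.sum_add_distrib, hxs]
            have : pstar j + ∑ i ∈ S.erase j, pstar i = ∑ i ∈ S, pstar i :=
              Finset.add_sum_erase S pstar hjS
            omega
          · unfold allocCost
            rw [hsd, Finset.sum_union hdis]
            congr 1
            · exact Finset.sum_congr rfl (fun i hi => by rw [hq1 i hi])
            · exact Finset.sum_congr rfl (fun i hi => by rw [hq2 i hi])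
        have h3 : ∑ i ∈ L \ S, (c i (pstar i + x i) - c i (pstar i)) ≤
            ∑ i ∈ L \ S, (c i (y i) - c i (y i - x i)) := by
          refine Finset.sum_le_sum (fun i hi => ?_)
          have ha := hx i hi
          have hb := hy i hi
          have := aux_conv (hmarg i) (show pstar i ≤ y i - x i by omega) (x i)
          rwa [show y i - x i + x i = y i by omega] at this
        rw [Finset.sum_sub_distrib, Finset.sum_sub_distrib] at h3
        have h4 : Jstar L = _ := hJL.trans (hsum (fun i => c i (pstar i)))
        have h5 := Finset.add_sum_erase S (fun i => c i (pstar i)) hjS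
        linarith
    have h := main S subset_rfl y hy1 (by omega)
    rw [Finset.sum_add_distrib] at h
    have h4 : Jstar L = _ := hJL.trans (hsum (fun i => c i (pstar i)))
    unfold allocCost at hre
    linarith
  refine ⟨?_, key⟩
  rw [Finset.sum_add_distrib]
  linarith
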